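/- arXiv:2103.03374 — 3 statements merged into one kernel-verified Lean document; each statement's English description precedes it below -/
import Mathlib

section
/- Let H = (V, E) be a finite hypergraph and k a natural number. If S and T are both k-quarks of H and S ∩ T ≠ ∅, then S = T; that is, distinct k-quarks (for the same k) are node-disjoint. -/
variable {V : Type*}

/-- Degree of node `v` in the hypergraph with hyperedge set `E` induced on `S`:
the number of hyperedges contained in `S` that contain `v`. -/
def hdeg [DecidableEq V] (E : Finset (Finset V)) (S : Finset V) (v : V) : ℕ :=
  (E.filter fun e => v ∈ e ∧ e ⊆ S).card

/-- Nodes `u` and `v` are connected in the hypergraph induced on `S`: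
there is a nonempty sequence of hyperedges of `H|_S` starting at an edge containing `u`,
ending at an edge containing `v`, with consecutive edges intersecting. -/
def HConn [DecidableEq V] (E : Finset (Finset V)) (S : Finset V) (u v : V) : Prop :=
  ∃ (l : List (Finset V)) (hl : l ≠ []),
    (∀ e ∈ l, e ∈ E ∧ e ⊆ S) ∧ u ∈ l.head hl ∧ v ∈ l.getLast hl ∧
    l.Chain' fun e f => (e ∩ f).Nonempty

/-- The hypergraph induced on `S` is connected. -/
def ConnectedOn [DecidableEq V] (E : Finset (Finset V)) (S : Finset V) : Prop :=
  ∀ u ∈ S, ∀ v ∈ S, HConn E S u v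

/-- `S` is a `k`-quark: the induced hypergraph is connected, has minimum degree at least `k`,
and `S` is maximal with these two properties. -/
def IsQuark [DecidableEq V] (E : Finset (Finset V)) (k : ℕ) (S : Finset V) : Prop :=
  ConnectedOn E S ∧ (∀ v ∈ S, k ≤ hdeg E S v) ∧
    ∀ T : Finset V, S ⊆ T → ConnectedOn E T → (∀ v ∈ T, k ≤ hdeg E T v) → T = S

/-- The quark number of `u`: the largest `k` such that `u` belongs to a nonempty `k`-quark. -/
noncomputable def quarkNum [DecidableEq V] (E : Finset (Finset V)) (u : V) : ℕ :=
  sSup {k : ℕ | ∃ S : Finset V, IsQuark E k S ∧ u ∈ S}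

theorem hdeg_mono [DecidableEq V] (E : Finset (Finset V)) {S T : Finset V} (h : S ⊆ T) (v : V) :
    hdeg E S v ≤ hdeg E T v :=
  Finset.card_le_card <| Finset.monotone_filter_right E fun _ _ he => ⟨he.1, he.2.trans h⟩

theorem HConn.mono [DecidableEq V] {E : Finset (Finset V)} {S T : Finset V} {u v : V}
    (h : S ⊆ T) (huv : HConn E S u v) : HConn E T u v := by
  obtain ⟨l, hl, hE, hu, hv, hc⟩ := huv
  exact ⟨l, hl, fun e he => ⟨(hE e he).1, (hE e he).2.trans h⟩, hu, hv, hc⟩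

theorem HConn.trans [DecidableEq V] {E : Finset (Finset V)} {S : Finset V} {u v w : V}
    (huv : HConn E S u v) (hvw : HConn E S v w) : HConn E S u w := by
  obtain ⟨l, hl, hE, hu, hv, hc⟩ := huv
  obtain ⟨m, hm, hE', hv', hw, hc'⟩ := hvw
  refine ⟨l ++ m, List.append_ne_nil_of_left_ne_nil hl m, fun e he => ?_, ?_, ?_, ?_⟩
  · exact (List.mem_append.1 he).elim (hE e) (hE' e)
  · rwa [List.head_append_of_ne_nil hl]
  · rwa [List.getLast_append_of_ne_nil _ hm]
  · refine List.isChain_append.2 ⟨hc, hc', fun e he f hf => ⟨v, Finset.mem_inter.2 ⟨?_, ?_⟩⟩⟩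
    · rw [List.getLast?_eq_some_getLast hl, Option.mem_some_iff] at he
      exact he ▸ hv
    · rw [List.head?_eq_some_head hm, Option.mem_some_iff] at hf
      exact hf ▸ hv'

theorem ConnectedOn.union [DecidableEq V] {E : Finset (Finset V)} {S T : Finset V}
    (hS : ConnectedOn E S) (hT : ConnectedOn E T) (hST : (S ∩ T).Nonempty) :
    ConnectedOn E (S ∪ T) := by
  obtain ⟨w, hw⟩ := hST
  obtain ⟨hwS, hwT⟩ := Finset.mem_inter.1 hw
  intro u hu v hv
  have huw : HConn E (S ∪ T) u w := (Finset.mem_union.1 hu).elim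
    (fun h => (hS u h w hwS).mono Finset.subset_union_left)
    (fun h => (hT u h w hwT).mono Finset.subset_union_right)
  have hwv : HConn E (S ∪ T) w v := (Finset.mem_union.1 hv).elim
    (fun h => (hS w hwS v h).mono Finset.subset_union_left)
    (fun h => (hT w hwT v h).mono Finset.subset_union_right)
  exact huw.trans hwv

/-- distinct `k`-quarks (same `k`) are node-disjoint. -/
theorem stmt_3 [Fintype V] [DecidableEq V] (E : Finset (Finset V)) (k : ℕ)
    (S T : Finset V) (hS : IsQuark E k S) (hT : IsQuark E k T)
    (hST : (S ∩ T).Nonempty) : S = T := by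
  have hconn := hS.1.union hT.1 hST
  have hdeg_union : ∀ v ∈ S ∪ T, k ≤ hdeg E (S ∪ T) v := fun v hv =>
    (Finset.mem_union.1 hv).elim
      (fun h => (hS.2.1 v h).trans (hdeg_mono E Finset.subset_union_left v))
      (fun h => (hT.2.1 v h).trans (hdeg_mono E Finset.subset_union_right v))
  exact (hS.2.2 _ Finset.subset_union_left hconn hdeg_union).symm.trans
    (hT.2.2 _ Finset.subset_union_right hconn hdeg_union)
end

section
/- Let H = (V, E) be a finite hypergraph and let k' ≤ k be natural numbers. If S is a k-quark of H, T is a k'-quark of H, and S ∩ T ≠ ∅, then S ⊆ T; that is, quarks with larger parameter intersecting quarks with smaller parameter are contained in them. -/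
variable {V : Type*}

/-- a `k`-quark intersecting a `k'`-quark with `k' ≤ k` is contained in it. -/
theorem stmt_5 [Fintype V] [DecidableEq V] (E : Finset (Finset V)) (k k' : ℕ)
    (hk : k' ≤ k) (S T : Finset V) (hS : IsQuark E k S) (hT : IsQuark E k' T)
    (hST : (S ∩ T).Nonempty) : S ⊆ T := by
  obtain ⟨hSc, hSd, -⟩ := hS
  obtain ⟨hTc, hTd, hTmax⟩ := hT
  refine Finset.union_eq_right.mp <|
    hTmax (S ∪ T) Finset.subset_union_right (hSc.union hTc hST) fun v hv => ?_
  rcases Finset.mem_union.mp hv with h | h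
  · exact (hk.trans (hSd v h)).trans (hdeg_mono E Finset.subset_union_left v)
  · exact (hTd v h).trans (hdeg_mono E Finset.subset_union_right v)
end

section
/- Let X be a finite set with |X| = n and let F be a nonempty finite family of 3-element subsets of X such that ⋃ F = X and F is connected under edge-sharing: for every A, B ∈ F there is a sequence A = T_1, T_2, …, T_ℓ = B of members of F with |T_i ∩ T_{i+1}| ≥ 2 for all i < ℓ. Then |F| ≥ n − 2. (In particular, a subgraph on n vertices whose triangles cover all vertices and are connected via shared edges contains at least n − 2 triangles, so its average number of triangles per vertex is at least (n − 2)/n.) -/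
/-- A chain that starts inside `p` and ends outside `p` has a consecutive pair leaving `p`. -/
theorem List.IsChain.exists_rel_of_head_of_not_getLast {α : Type*} {R : α → α → Prop}
    {p : α → Prop} {l : List α} (h : l.IsChain R) (hl : l ≠ [])
    (hhead : p (l.head hl)) (hlast : ¬ p (l.getLast hl)) :
    ∃ a ∈ l, ∃ b ∈ l, p a ∧ ¬ p b ∧ R a b := by
  induction l with
  | nil => exact absurd rfl hl
  | cons a t ih =>
    cases t with
    | nil => exact absurd hhead hlast
    | cons b t =>
      rw [List.isChain_cons_cons] at h
      by_cases hb : p b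
      · obtain ⟨c, hc, d, hd, hcd⟩ := ih h.2 (by simp) hb (by simpa using hlast)
        exact ⟨c, List.mem_cons_of_mem _ hc, d, List.mem_cons_of_mem _ hd, hcd⟩
      · exact ⟨a, by simp, b, by simp, hhead, hb, h.1⟩

/-- Adding a triple that shares two points with a member of `G` enlarges the union by at most
one point. -/
theorem Finset.card_biUnion_insert_le_of_two_le_card_inter {X : Type*} [DecidableEq X]
    {G : Finset (Finset X)} {S T : Finset X} (hS : S ∈ G) (hT : T.card = 3)
    (hST : 2 ≤ (S ∩ T).card) :
    ((insert T G).biUnion id).card ≤ (G.biUnion id).card + 1 := by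
  have hsub : S ∩ T ⊆ T ∩ G.biUnion id := fun x hx => by
    rw [Finset.mem_inter] at hx
    exact Finset.mem_inter.2 ⟨hx.2, Finset.mem_biUnion.2 ⟨S, hS, hx.1⟩⟩
  have hinter := Finset.card_le_card hsub
  have hunion := Finset.card_union_add_card_inter T (G.biUnion id)
  rw [Finset.biUnion_insert, id]
  omega


/-- if `F` is a nonempty family of 3-element subsets of a finite set `X` with
`|X| = n`, covering all of `X`, and connected under edge-sharing (any two members are joined
by a chain of members in which consecutive members share at least 2 elements), then
`|F| ≥ n - 2`. -/
theorem stmt_12 {X : Type*} [Fintype X] [DecidableEq X] (n : ℕ)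
    (hn : Fintype.card X = n) (F : Finset (Finset X)) (hne : F.Nonempty)
    (h3 : ∀ A ∈ F, A.card = 3) (hcov : ∀ x : X, ∃ A ∈ F, x ∈ A)
    (hconn : ∀ A ∈ F, ∀ B ∈ F,
      ∃ (l : List (Finset X)) (hl : l ≠ []),
        (∀ T ∈ l, T ∈ F) ∧ l.head hl = A ∧ l.getLast hl = B ∧
        l.Chain' fun T T' => 2 ≤ (T ∩ T').card) :
    n - 2 ≤ F.card := by
  classical
  obtain ⟨A, hA⟩ := hne
  obtain ⟨G, hG, hmax⟩ := Finset.exists_max_image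
    (F.powerset.filter fun G => A ∈ G ∧ (G.biUnion id).card ≤ G.card + 2) Finset.card
    ⟨{A}, by simp [hA, h3 A hA]⟩
  simp only [Finset.mem_filter, Finset.mem_powerset] at hG hmax
  obtain ⟨hGF, hAG, hcard⟩ := hG
  have hFG : F ⊆ G := by
    intro B hB
    by_contra hBG
    obtain ⟨l, hl, hlF, hhead, hlast, hchain⟩ := hconn A hA B hB
    obtain ⟨S, -, T, hTl, hSG, hTG, hST⟩ :=
      hchain.exists_rel_of_head_of_not_getLast (p := (· ∈ G)) hl
        (hhead ▸ hAG) (hlast ▸ hBG)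
    have hT := hlF T hTl
    have hle := Finset.card_biUnion_insert_le_of_two_le_card_inter hSG (h3 T hT) hST
    have hins := Finset.card_insert_of_notMem hTG
    have := hmax (insert T G) ⟨Finset.insert_subset hT hGF,
      Finset.mem_insert_of_mem hAG, by omega⟩
    omega
  have huniv : F.biUnion id = Finset.univ := by
    ext x
    simpa using hcov x
  rw [Finset.Subset.antisymm hGF hFG, huniv, Finset.card_univ, hn] at hcard
  omega
end
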